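/- Let n ≥ 2 and let λ be a partition of n with associated irreducible complex representation (Specht module) V_λ of the symmetric group S_n. The operator Σ_{i=2}^n ρ_λ((1 i)) (the sum of the representation matrices of the transpositions moving the letter 1) is a scalar multiple of the identity on V_λ if and only if λ is a rectangular partition λ = (d, d, …, d) with k equal parts (so n = kd); in that case the scalar equals d − k. -/

import Mathlib

open MonoidAlgebra

/-- The row symmetrizer of the Young tableau `T` (a filling of the Young diagram `μ` by the
letters `Fin n`): the sum in `ℂ[S_n]` of the permutations preserving each row of `T`. -/
noncomputable def rowSymmetrizer (μ : YoungDiagram) {n : ℕ} (T : Fin n ≃ μ.cells) :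
    MonoidAlgebra ℂ (Equiv.Perm (Fin n)) :=
  ∑ p ∈ Finset.univ.filter
      (fun g : Equiv.Perm (Fin n) => ∀ m, ((T (g m)) : ℕ × ℕ).1 = ((T m) : ℕ × ℕ).1),
    MonoidAlgebra.single p 1

/-- The column antisymmetrizer of the Young tableau `T`: the signed sum in `ℂ[S_n]` of the
permutations preserving each column of `T`. -/
noncomputable def colSymmetrizer (μ : YoungDiagram) {n : ℕ} (T : Fin n ≃ μ.cells) :
    MonoidAlgebra ℂ (Equiv.Perm (Fin n)) :=
  ∑ q ∈ Finset.univ.filter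
      (fun g : Equiv.Perm (Fin n) => ∀ m, ((T (g m)) : ℕ × ℕ).2 = ((T m) : ℕ × ℕ).2),
    MonoidAlgebra.single q ((Equiv.Perm.sign q : ℤ) : ℂ)

/-- The Young symmetrizer `c_μ = (Σ_{p ∈ P} p)(Σ_{q ∈ Q} sgn(q) q)`. -/
noncomputable def youngSymmetrizer (μ : YoungDiagram) {n : ℕ} (T : Fin n ≃ μ.cells) :
    MonoidAlgebra ℂ (Equiv.Perm (Fin n)) :=
  rowSymmetrizer μ T * colSymmetrizer μ T

/-- The Specht module `V_μ`: the left ideal `ℂ[S_n]·c_μ` generated by the Young symmetrizer,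
with `S_n` acting by left multiplication. -/
noncomputable def spechtIdeal (μ : YoungDiagram) {n : ℕ} (T : Fin n ≃ μ.cells) :
    Submodule (MonoidAlgebra ℂ (Equiv.Perm (Fin n))) (MonoidAlgebra ℂ (Equiv.Perm (Fin n))) :=
  Submodule.span _ {youngSymmetrizer μ T}

section RowsAndColumns

variable {n : ℕ} {μ : YoungDiagram} (T : Fin n ≃ μ.cells)

lemma single_swap_mul_rowSymmetrizer {x y : Fin n} (h : (T x : ℕ × ℕ).1 = (T y : ℕ × ℕ).1) :
    single (Equiv.swap x y) (1 : ℂ) * rowSymmetrizer μ T = rowSymmetrizer μ T := by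
  have key : ∀ m, (T (Equiv.swap x y m) : ℕ × ℕ).1 = (T m : ℕ × ℕ).1 := by
    intro m
    rw [Equiv.swap_apply_def]
    split_ifs with h1 h2 <;> simp_all
  unfold rowSymmetrizer
  rw [Finset.mul_sum]
  refine Finset.sum_bij' (fun p _ => Equiv.swap x y * p) (fun p _ => Equiv.swap x y * p)
    ?_ ?_ ?_ ?_ ?_
  · intro p hp
    simp only [Finset.mem_filter, Finset.mem_univ, true_and] at hp ⊢
    intro m
    rw [Equiv.Perm.mul_apply, key, hp]
  · intro p hp
    simp only [Finset.mem_filter, Finset.mem_univ, true_and] at hp ⊢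
    intro m
    rw [Equiv.Perm.mul_apply, key, hp]
  · intro p _
    simp
  · intro p _
    simp
  · intro p _
    simp [single_mul_single]

lemma single_swap_mul_colSymmetrizer {x y : Fin n} (hxy : x ≠ y)
    (h : (T x : ℕ × ℕ).2 = (T y : ℕ × ℕ).2) :
    single (Equiv.swap x y) (1 : ℂ) * colSymmetrizer μ T = -colSymmetrizer μ T := by
  have key : ∀ m, (T (Equiv.swap x y m) : ℕ × ℕ).2 = (T m : ℕ × ℕ).2 := by
    intro m
    rw [Equiv.swap_apply_def]
    split_ifs with h1 h2 <;> simp_all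
  unfold colSymmetrizer
  rw [Finset.mul_sum, ← Finset.sum_neg_distrib]
  refine Finset.sum_bij' (fun p _ => Equiv.swap x y * p) (fun p _ => Equiv.swap x y * p)
    ?_ ?_ ?_ ?_ ?_
  · intro p hp
    simp only [Finset.mem_filter, Finset.mem_univ, true_and] at hp ⊢
    intro m
    rw [Equiv.Perm.mul_apply, key, hp]
  · intro p hp
    simp only [Finset.mem_filter, Finset.mem_univ, true_and] at hp ⊢
    intro m
    rw [Equiv.Perm.mul_apply, key, hp]
  · intro p _
    simp
  · intro p _
    simp
  · intro p _
    rw [single_mul_single, Equiv.Perm.sign_mul, Equiv.Perm.sign_swap hxy, ← single_neg]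
    simp

lemma coeff_youngSymmetrizer_one : (youngSymmetrizer μ T).coeff 1 = 1 := by
  unfold youngSymmetrizer rowSymmetrizer colSymmetrizer
  rw [Finset.sum_mul_sum, ← Finset.sum_product', coeff_sum, Finsupp.finsetSum_apply,
    Finset.sum_eq_single (1, 1)]
  · simp [single_mul_single]
  · rintro ⟨p, q⟩ hpq hne
    simp only [Finset.mem_product, Finset.mem_filter, Finset.mem_univ, true_and] at hpq
    obtain ⟨hp, hq⟩ := hpq
    rw [single_mul_single, coeff_single, Finsupp.single_apply, if_neg]
    intro h
    apply hne
    have hpq' : ∀ m, p (q m) = m := fun m => by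
      rw [← Equiv.Perm.mul_apply, h, Equiv.Perm.one_apply]
    have hq1 : q = 1 := by
      ext1 m
      apply T.injective
      apply Subtype.ext
      refine Prod.ext ?_ (hq m)
      rw [Equiv.Perm.one_apply, ← hp (q m), hpq']
    subst hq1
    simpa using h
  · simp

lemma youngSymmetrizer_ne_zero : youngSymmetrizer μ T ≠ 0 := by
  intro h
  have := coeff_youngSymmetrizer_one T
  rw [h] at this
  simp at this

/-- The Garnir-type relation: the transpositions exchanging `m` with the letters of another row,
at least as long as the row of `m`, sum to `-1` on the Young symmetrizer. -/
lemma sum_single_swap_mul_youngSymmetrizer {m : Fin n} {r : ℕ} (hr : (T m : ℕ × ℕ).1 ≠ r)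
    (hlen : μ.rowLen (T m : ℕ × ℕ).1 ≤ μ.rowLen r) :
    ∑ j with (T j : ℕ × ℕ).1 = r, single (Equiv.swap m j) (1 : ℂ) * youngSymmetrizer μ T =
      -youngSymmetrizer μ T := by
  set P := Finset.univ.filter
    (fun g : Equiv.Perm (Fin n) => ∀ m, ((T (g m)) : ℕ × ℕ).1 = ((T m) : ℕ × ℕ).1) with hP
  set R := Finset.univ.filter (fun j : Fin n => (T j : ℕ × ℕ).1 = r) with hR
  have hmemP : ∀ p, p ∈ P ↔ ∀ m, (T (p m) : ℕ × ℕ).1 = (T m : ℕ × ℕ).1 := by simp [hP]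
  have hmemR : ∀ j, j ∈ R ↔ (T j : ℕ × ℕ).1 = r := by simp [hR]
  have hinv : ∀ p ∈ P, ∀ j, (T (p.symm j) : ℕ × ℕ).1 = (T j : ℕ × ℕ).1 := by
    intro p hp j
    rw [← (hmemP p).1 hp, Equiv.apply_symm_apply]
  have hex : ∀ x : Fin n, ∃ y, (T x : ℕ × ℕ).1 = (T m : ℕ × ℕ).1 →
      (T y : ℕ × ℕ).1 = r ∧ (T x : ℕ × ℕ).2 = (T y : ℕ × ℕ).2 := by
    intro x
    by_cases hx : (T x : ℕ × ℕ).1 = (T m : ℕ × ℕ).1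
    · have hmem : ((T x : ℕ × ℕ).1, (T x : ℕ × ℕ).2) ∈ μ := (T x).2
      rw [YoungDiagram.mem_iff_lt_rowLen, hx] at hmem
      have hmem' : (r, (T x : ℕ × ℕ).2) ∈ μ :=
        YoungDiagram.mem_iff_lt_rowLen.2 (hmem.trans_le hlen)
      exact ⟨T.symm ⟨_, hmem'⟩, fun _ => by simp⟩
    · exact ⟨x, fun h => absurd h hx⟩
  choose y hy using hex
  have hyr : ∀ p ∈ P, (T (y (p.symm m)) : ℕ × ℕ).1 = r := fun p hp =>
    (hy _ (hinv p hp m)).1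
  have hyc : ∀ p ∈ P, (T (p.symm m) : ℕ × ℕ).2 = (T (y (p.symm m)) : ℕ × ℕ).2 := fun p hp =>
    (hy _ (hinv p hp m)).2
  have hxR : ∀ p ∈ P, ∀ j ∈ R, p.symm m ≠ j := by
    rintro p hp j hj rfl
    exact hr ((hinv p hp m).symm.trans ((hmemR _).1 hj))
  have hanti : ∀ p ∈ P, single (Equiv.swap (p.symm m) (y (p.symm m))) (1 : ℂ) *
      colSymmetrizer μ T = -colSymmetrizer μ T := fun p hp =>
    single_swap_mul_colSymmetrizer T (hxR p hp _ ((hmemR _).2 (hyr p hp))) (hyc p hp)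
  have hreindex : ∀ p ∈ P, ∑ j ∈ R, single (Equiv.swap m j) (1 : ℂ) *
      (single p 1 * colSymmetrizer μ T) =
      ∑ j ∈ R, single (p * Equiv.swap (p.symm m) j) (1 : ℂ) * colSymmetrizer μ T := by
    intro p hp
    refine Finset.sum_bij' (fun j _ => p.symm j) (fun j _ => p j) ?_ ?_ ?_ ?_ ?_
    · intro j hj
      rw [hmemR, hinv p hp]
      exact (hmemR j).1 hj
    · intro j hj
      rw [hmemR, (hmemP p).1 hp]
      exact (hmemR j).1 hj
    · intro j _
      simp
    · intro j _
      simp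
    · intro j _
      rw [← mul_assoc, single_mul_single, Equiv.mul_swap_eq_swap_mul]
      simp
  have hsplit : ∀ p ∈ P, ∑ j ∈ R, single (p * Equiv.swap (p.symm m) j) (1 : ℂ) *
      colSymmetrizer μ T = -(single p 1 * colSymmetrizer μ T) +
      ∑ j ∈ R.erase (y (p.symm m)), single (p * Equiv.swap (p.symm m) j) (1 : ℂ) *
        colSymmetrizer μ T := by
    intro p hp
    rw [← Finset.add_sum_erase R _ ((hmemR _).2 (hyr p hp))]
    congr 1
    rw [← mul_neg, ← hanti p hp, ← mul_assoc, single_mul_single, mul_one]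
  have hcancel : ∑ p ∈ P, ∑ j ∈ R.erase (y (p.symm m)),
      single (p * Equiv.swap (p.symm m) j) (1 : ℂ) * colSymmetrizer μ T = 0 := by
    have hfix : ∀ p ∈ P, ∀ j ∈ R,
        (p * Equiv.swap (y (p.symm m)) j).symm m = p.symm m := by
      intro p hp j hj
      rw [Equiv.symm_apply_eq, Equiv.Perm.mul_apply, Equiv.swap_apply_of_ne_of_ne
        (hxR p hp _ ((hmemR _).2 (hyr p hp))) (hxR p hp _ hj), Equiv.apply_symm_apply]
    rw [Finset.sum_sigma']
    refine Finset.sum_involution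
      (fun s _ => ⟨s.1 * Equiv.swap (y (s.1.symm m)) s.2, s.2⟩) ?_ ?_ ?_ ?_
    · rintro ⟨p, j⟩ hpj
      simp only [Finset.mem_sigma, Finset.mem_erase] at hpj
      obtain ⟨hp, hjy, hj⟩ := hpj
      simp only
      rw [hfix p hp j hj]
      have hswap : p * Equiv.swap (y (p.symm m)) j * Equiv.swap (p.symm m) j =
          p * Equiv.swap (p.symm m) j * Equiv.swap (p.symm m) (y (p.symm m)) := by
        rw [mul_assoc, mul_assoc, Equiv.mul_swap_eq_swap_mul (Equiv.swap (p.symm m) j) (p.symm m),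
          Equiv.swap_apply_left,
          Equiv.swap_apply_of_ne_of_ne (hxR p hp _ ((hmemR _).2 (hyr p hp))).symm hjy.symm,
          Equiv.swap_comm j]
      have hsingle : single (p * Equiv.swap (p.symm m) j *
          Equiv.swap (p.symm m) (y (p.symm m))) (1 : ℂ) =
          single (p * Equiv.swap (p.symm m) j) 1 *
            single (Equiv.swap (p.symm m) (y (p.symm m))) 1 := by
        rw [single_mul_single, mul_one]
      rw [hswap, hsingle, mul_assoc, hanti p hp, mul_neg, add_neg_cancel]
    · rintro ⟨p, j⟩ hpj _ heq
      simp only [Finset.mem_sigma, Finset.mem_erase] at hpj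
      have h1 := congrArg Sigma.fst heq
      simp only [mul_eq_left] at h1
      exact hpj.2.1 (Equiv.swap_eq_one_iff.1 h1).symm
    · rintro ⟨p, j⟩ hpj
      simp only [Finset.mem_sigma, Finset.mem_erase] at hpj ⊢
      obtain ⟨hp, hjy, hj⟩ := hpj
      rw [hfix p hp j hj]
      refine ⟨?_, hjy, hj⟩
      rw [hmemP]
      intro l
      rw [Equiv.Perm.mul_apply, (hmemP p).1 hp, Equiv.swap_apply_def]
      have h1 := hyr p hp
      have h2 := (hmemR j).1 hj
      split_ifs with h3 h4 <;> simp_all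
    · rintro ⟨p, j⟩ hpj
      simp only [Finset.mem_sigma, Finset.mem_erase] at hpj
      obtain ⟨hp, hjy, hj⟩ := hpj
      simp only
      rw [hfix p hp j hj, mul_assoc, Equiv.swap_mul_self, mul_one]
  have hexpand : youngSymmetrizer μ T = ∑ p ∈ P, single p 1 * colSymmetrizer μ T := by
    rw [youngSymmetrizer, rowSymmetrizer, Finset.sum_mul]
  rw [hexpand]
  simp only [Finset.mul_sum]
  rw [Finset.sum_comm, Finset.sum_congr rfl hreindex, Finset.sum_congr rfl hsplit,
    Finset.sum_add_distrib, hcancel, add_zero, Finset.sum_neg_distrib]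

lemma card_filter_row_eq_rowLen (r : ℕ) :
    (Finset.univ.filter fun j : Fin n => (T j : ℕ × ℕ).1 = r).card = μ.rowLen r := by
  rw [YoungDiagram.rowLen_eq_card]
  refine Finset.card_bij (fun j _ => (T j : ℕ × ℕ)) ?_ ?_ ?_
  · intro j hj
    rw [YoungDiagram.mem_row_iff]
    exact ⟨(T j).2, (Finset.mem_filter.1 hj).2⟩
  · intro i _ j _ h
    exact T.injective (Subtype.ext h)
  · intro c hc
    rw [YoungDiagram.mem_row_iff] at hc
    exact ⟨T.symm ⟨c, hc.1⟩, by simp [hc.2], by simp⟩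

lemma sum_single_swap_row_self_mul_youngSymmetrizer (m : Fin n) :
    ∑ j with (T j : ℕ × ℕ).1 = (T m : ℕ × ℕ).1,
      single (Equiv.swap m j) (1 : ℂ) * youngSymmetrizer μ T =
      (μ.rowLen (T m : ℕ × ℕ).1 : ℂ) • youngSymmetrizer μ T := by
  rw [Finset.sum_congr rfl (g := fun _ => youngSymmetrizer μ T), Finset.sum_const,
    card_filter_row_eq_rowLen, Nat.cast_smul_eq_nsmul]
  intro j hj
  rw [youngSymmetrizer, ← mul_assoc,
    single_swap_mul_rowSymmetrizer T (Finset.mem_filter.1 hj).2.symm]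

/-- The sum of all transpositions moving the letter `m`. -/
noncomputable def starSum (m : Fin n) : MonoidAlgebra ℂ (Equiv.Perm (Fin n)) :=
  ∑ i ∈ Finset.univ.erase m, single (Equiv.swap m i) (1 : ℂ)

lemma starSum_mul (m : Fin n) (c : MonoidAlgebra ℂ (Equiv.Perm (Fin n))) :
    starSum m * c = ∑ j, single (Equiv.swap m j) (1 : ℂ) * c - c := by
  rw [starSum, Finset.sum_mul, ← Finset.add_sum_erase _ _ (Finset.mem_univ m), Equiv.swap_self,
    eq_sub_iff_add_eq, add_comm]
  congr 1
  exact (one_mul c).symm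

lemma starSum_mul_single (m : Fin n) (g : Equiv.Perm (Fin n)) (z : ℂ) :
    starSum (g m) * single g z = single g z * starSum m := by
  rw [starSum, starSum, Finset.sum_mul, Finset.mul_sum]
  refine Finset.sum_bij' (fun j _ => g.symm j) (fun j _ => g j) ?_ ?_ ?_ ?_ ?_
  · intro j hj
    simpa [Equiv.symm_apply_eq] using hj
  · intro j hj
    simpa using hj
  · intro j _
    simp
  · intro j _
    simp
  · intro j _
    rw [single_mul_single, single_mul_single, Equiv.mul_swap_eq_swap_mul]
    simp

lemma fst_lt_colLen_zero (m : Fin n) : (T m : ℕ × ℕ).1 < μ.colLen 0 := by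
  rw [← YoungDiagram.mem_iff_lt_colLen]
  exact μ.up_left_mem le_rfl (Nat.zero_le _) (T m).2

/-- If the letter `m` lies in a row of minimal length, the star sum at `m` acts on the Young
symmetrizer as the length of that row minus the number of rows. -/
lemma starSum_mul_youngSymmetrizer {m : Fin n}
    (hmin : ∀ r < μ.colLen 0, μ.rowLen (T m : ℕ × ℕ).1 ≤ μ.rowLen r) :
    starSum m * youngSymmetrizer μ T =
      ((μ.rowLen (T m : ℕ × ℕ).1 : ℂ) - μ.colLen 0) • youngSymmetrizer μ T := by
  have hm := fst_lt_colLen_zero T m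
  rw [starSum_mul, ← Finset.sum_fiberwise_of_maps_to (t := Finset.range (μ.colLen 0))
    (g := fun j => (T j : ℕ × ℕ).1) (fun j _ => Finset.mem_range.2 (fst_lt_colLen_zero T j)),
    ← Finset.add_sum_erase _ _ (Finset.mem_range.2 hm),
    sum_single_swap_row_self_mul_youngSymmetrizer,
    Finset.sum_congr rfl (g := fun _ => -youngSymmetrizer μ T)]
  · rw [Finset.sum_const, Finset.card_erase_of_mem (Finset.mem_range.2 hm), Finset.card_range,
      ← Nat.cast_smul_eq_nsmul ℂ, Nat.cast_sub (by omega)]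
    push_cast
    module
  · intro r hr
    rw [Finset.mem_erase, Finset.mem_range] at hr
    exact sum_single_swap_mul_youngSymmetrizer T hr.1.symm (hmin r hr.2)

lemma sum_starSum_mul_youngSymmetrizer :
    ∑ m with (T m : ℕ × ℕ).1 = 0, starSum m * youngSymmetrizer μ T =
      ((μ.rowLen 0 : ℂ) ^ 2 - n) • youngSymmetrizer μ T := by
  have hcard := Finset.card_filter_add_card_filter_not (s := (Finset.univ : Finset (Fin n)))
    (fun j => (T j : ℕ × ℕ).1 = 0)
  rw [card_filter_row_eq_rowLen, Finset.card_univ, Fintype.card_fin] at hcard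
  have hcard' := congrArg (Nat.cast : ℕ → ℂ) hcard
  rw [Nat.cast_add] at hcard'
  have hsame : ∀ m ∈ Finset.univ.filter (fun m : Fin n => (T m : ℕ × ℕ).1 = 0),
      starSum m * youngSymmetrizer μ T =
        ((μ.rowLen 0 : ℂ) - 1) • youngSymmetrizer μ T +
        ∑ j with ¬ (T j : ℕ × ℕ).1 = 0,
          single (Equiv.swap j m) (1 : ℂ) * youngSymmetrizer μ T := by
    intro m hm
    have hm0 := (Finset.mem_filter.1 hm).2
    have h := sum_single_swap_row_self_mul_youngSymmetrizer T m
    rw [hm0] at h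
    rw [starSum_mul, ← Finset.sum_filter_add_sum_filter_not _ (fun j => (T j : ℕ × ℕ).1 = 0), h]
    simp only [Equiv.swap_comm m]
    module
  rw [Finset.sum_congr rfl hsame, Finset.sum_add_distrib, Finset.sum_comm,
    Finset.sum_congr rfl (g := fun _ => -youngSymmetrizer μ T) (fun j hj =>
      sum_single_swap_mul_youngSymmetrizer T (Finset.mem_filter.1 hj).2
        (μ.rowLen_anti _ _ (Nat.zero_le _))),
    Finset.sum_const, Finset.sum_const, card_filter_row_eq_rowLen,
    ← Nat.cast_smul_eq_nsmul ℂ, ← Nat.cast_smul_eq_nsmul ℂ, eq_sub_of_add_eq' hcard']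
  module

lemma starSum_acts_as_scalar_iff (m₀ : Fin n) (z : ℂ) :
    (∀ v ∈ spechtIdeal μ T, starSum m₀ * v = z • v) ↔
      ∀ m, starSum m * youngSymmetrizer μ T = z • youngSymmetrizer μ T := by
  constructor
  · intro h m
    have h1 := h (single (Equiv.swap m₀ m) (1 : ℂ) * youngSymmetrizer μ T)
      (Submodule.mem_span_singleton.2 ⟨_, rfl⟩)
    have h2 := starSum_mul_single m (Equiv.swap m₀ m) 1
    rw [Equiv.swap_apply_right] at h2
    rw [← mul_assoc, h2, mul_assoc, ← mul_smul_comm] at h1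
    have h3 := congrArg (single (Equiv.swap m₀ m) (1 : ℂ) * ·) h1
    simpa only [← mul_assoc, single_mul_single, Equiv.swap_mul_self, mul_one, ← one_def,
      one_mul] using h3
  · intro h v hv
    obtain ⟨w, rfl⟩ := Submodule.mem_span_singleton.1 hv
    rw [smul_eq_mul]
    induction w using MonoidAlgebra.induction_linear with
    | zero => simp
    | add f g hf hg =>
      rw [add_mul, mul_add, smul_add,
        hf (Submodule.mem_span_singleton.2 ⟨_, rfl⟩), hg (Submodule.mem_span_singleton.2 ⟨_, rfl⟩)]
    | single g r =>
      have h2 := starSum_mul_single (g.symm m₀) g r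
      rw [Equiv.apply_symm_apply] at h2
      rw [← mul_assoc, h2, mul_assoc, h, mul_smul_comm]

end RowsAndColumns

lemma YoungDiagram.cells_subset_range_product (μ : YoungDiagram) :
    μ.cells ⊆ Finset.range (μ.colLen 0) ×ˢ Finset.range (μ.rowLen 0) := by
  rintro ⟨i, j⟩ hij
  rw [Finset.mem_product, Finset.mem_range, Finset.mem_range, ← YoungDiagram.mem_iff_lt_colLen,
    ← YoungDiagram.mem_iff_lt_rowLen]
  exact ⟨μ.up_left_mem le_rfl (Nat.zero_le _) hij, μ.up_left_mem (Nat.zero_le _) le_rfl hij⟩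

lemma YoungDiagram.cells_eq_range_product_of_rowLen_eq {μ : YoungDiagram}
    (h : μ.rowLen (μ.colLen 0 - 1) = μ.rowLen 0) :
    μ.cells = Finset.range (μ.colLen 0) ×ˢ Finset.range (μ.rowLen 0) := by
  refine μ.cells_subset_range_product.antisymm ?_
  rintro ⟨i, j⟩ hij
  rw [Finset.mem_product, Finset.mem_range, Finset.mem_range] at hij
  have hj : j < μ.rowLen (μ.colLen 0 - 1) := h ▸ hij.2
  exact μ.up_left_mem (Nat.le_sub_one_of_lt hij.1) le_rfl (YoungDiagram.mem_iff_lt_rowLen.2 hj)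

lemma YoungDiagram.rowLen_eq_of_cells_eq {μ : YoungDiagram} {k d : ℕ}
    (h : μ.cells = Finset.range k ×ˢ Finset.range d) {r : ℕ} (hr : r < k) : μ.rowLen r = d := by
  have key : ∀ j, j < μ.rowLen r ↔ j < d := fun j => by
    rw [← YoungDiagram.mem_iff_lt_rowLen, ← YoungDiagram.mem_cells, h]
    simp [hr]
  exact le_antisymm (le_of_not_gt fun hlt => lt_irrefl _ ((key d).1 hlt))
    (le_of_not_gt fun hlt => lt_irrefl _ ((key _).2 hlt))

lemma YoungDiagram.colLen_eq_of_cells_eq {μ : YoungDiagram} {k d : ℕ}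
    (h : μ.cells = Finset.range k ×ˢ Finset.range d) {c : ℕ} (hc : c < d) : μ.colLen c = k := by
  have key : ∀ i, i < μ.colLen c ↔ i < k := fun i => by
    rw [← YoungDiagram.mem_iff_lt_colLen, ← YoungDiagram.mem_cells, h]
    simp [hc]
  exact le_antisymm (le_of_not_gt fun hlt => lt_irrefl _ ((key k).1 hlt))
    (le_of_not_gt fun hlt => lt_irrefl _ ((key _).2 hlt))

section Rectangular

variable {n : ℕ} {μ : YoungDiagram} (T : Fin n ≃ μ.cells)

lemma starSum_mul_youngSymmetrizer_of_rectangular {k d : ℕ}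
    (h : μ.cells = Finset.range k ×ˢ Finset.range d) (m : Fin n) :
    starSum m * youngSymmetrizer μ T = ((d : ℂ) - k) • youngSymmetrizer μ T := by
  have hm : (T m : ℕ × ℕ) ∈ Finset.range k ×ˢ Finset.range d := h ▸ (T m).2
  rw [Finset.mem_product, Finset.mem_range, Finset.mem_range] at hm
  have hrow := fun {r} => YoungDiagram.rowLen_eq_of_cells_eq h (r := r)
  have hcol : μ.colLen 0 = k := YoungDiagram.colLen_eq_of_cells_eq h (by omega)
  rw [starSum_mul_youngSymmetrizer T, hrow hm.1, hcol]
  intro r hr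
  rw [hrow hm.1, hrow (hcol ▸ hr)]

lemma rectangular_of_starSum_mul_youngSymmetrizer (m₀ : Fin n) {z : ℂ}
    (h : ∀ m, starSum m * youngSymmetrizer μ T = z • youngSymmetrizer μ T) :
    μ.cells = Finset.range (μ.colLen 0) ×ˢ Finset.range (μ.rowLen 0) := by
  have hpos : 0 < μ.colLen 0 := (Nat.zero_le _).trans_lt (fst_lt_colLen_zero T m₀)
  have hcorner : (μ.colLen 0 - 1, 0) ∈ μ :=
    YoungDiagram.mem_iff_lt_colLen.2 (Nat.sub_one_lt_of_lt hpos)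
  have hlast := starSum_mul_youngSymmetrizer T (m := T.symm ⟨_, hcorner⟩) (by
    intro r hr
    rw [Equiv.apply_symm_apply]
    exact μ.rowLen_anti _ _ (Nat.le_sub_one_of_lt hr))
  rw [h, Equiv.apply_symm_apply] at hlast
  have hz := smul_left_injective ℂ (youngSymmetrizer_ne_zero T) hlast
  have hfirst := sum_starSum_mul_youngSymmetrizer T
  simp only [h] at hfirst
  rw [Finset.sum_const, card_filter_row_eq_rowLen, ← Nat.cast_smul_eq_nsmul ℂ, smul_smul]
    at hfirst
  have hz' := smul_left_injective ℂ (youngSymmetrizer_ne_zero T) hfirst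
  rw [hz] at hz'
  have hint : (μ.rowLen 0 : ℤ) * (μ.rowLen (μ.colLen 0 - 1) - μ.colLen 0) =
      (μ.rowLen 0 : ℤ) ^ 2 - n := by exact_mod_cast hz'
  have hn : n ≤ μ.colLen 0 * μ.rowLen 0 := by
    have h1 := Finset.card_le_card μ.cells_subset_range_product
    have h2 := Fintype.card_congr T
    rw [Fintype.card_fin, Fintype.card_coe] at h2
    rwa [← h2, Finset.card_product, Finset.card_range, Finset.card_range] at h1
  have hanti := μ.rowLen_anti _ _ (Nat.zero_le (μ.colLen 0 - 1))
  have hrow : 0 < μ.rowLen 0 :=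
    YoungDiagram.mem_iff_lt_rowLen.1 (μ.up_left_mem (Nat.zero_le _) le_rfl hcorner)
  refine YoungDiagram.cells_eq_range_product_of_rowLen_eq (hanti.antisymm ?_)
  zify at hn hrow ⊢
  nlinarith

end Rectangular

/-- for `n ≥ 2` and a partition `μ` of `n` with Specht module `V_μ ⊆ ℂ[S_n]`,
the operator `Σ_{i=2}^n ρ_μ((1 i))` (sum of the transpositions moving the letter `1`, acting
by left multiplication on `V_μ`) is a scalar multiple of the identity iff `μ` is a rectangular
partition `(d^k)`; in that case the scalar is `d − k`. -/
theorem jucys_murphy_scalar_iff_rectangular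
    (n : ℕ) (hn : 2 ≤ n) (μ : YoungDiagram) (hcard : μ.card = n) (T : Fin n ≃ μ.cells)
    (a : MonoidAlgebra ℂ (Equiv.Perm (Fin n)))
    (ha : a = ∑ i ∈ Finset.univ.erase (⟨0, by omega⟩ : Fin n),
      MonoidAlgebra.single (Equiv.swap (⟨0, by omega⟩ : Fin n) i) (1 : ℂ)) :
    ((∃ z : ℂ, ∀ v ∈ spechtIdeal μ T, a * v = z • v) ↔
      ∃ k d : ℕ, μ.cells = Finset.range k ×ˢ Finset.range d) ∧
    (∀ k d : ℕ, μ.cells = Finset.range k ×ˢ Finset.range d →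
      ∀ v ∈ spechtIdeal μ T, a * v = ((d : ℂ) - (k : ℂ)) • v) := by
  have hstar : a = starSum ⟨0, by omega⟩ := ha
  rw [hstar]
  have hrect : ∀ k d : ℕ, μ.cells = Finset.range k ×ˢ Finset.range d →
      ∀ v ∈ spechtIdeal μ T, starSum ⟨0, by omega⟩ * v = ((d : ℂ) - (k : ℂ)) • v :=
    fun k d h => (starSum_acts_as_scalar_iff T _ _).2
      (starSum_mul_youngSymmetrizer_of_rectangular T h)
  refine ⟨⟨?_, ?_⟩, hrect⟩
  · rintro ⟨z, hz⟩
    exact ⟨_, _, rectangular_of_starSum_mul_youngSymmetrizer T ⟨0, by omega⟩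
      ((starSum_acts_as_scalar_iff T _ z).1 hz)⟩
  · rintro ⟨k, d, h⟩
    exact ⟨_, hrect k d h⟩
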